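/- For every T ∈ R(V) the Weyl-type part of T decomposes with respect to u as: Weyl(T) = Weyl_u(T^∥) + ε (u ⊛ T̂^{⊥∥}) + (1/(n−2)) ((n−3) T̂^⊥ − ε hat(Ric(T^∥))) ∧ η. -/

import Mathlib

open scoped BigOperators

noncomputable section

namespace Decomp

abbrev Vec (n : ℕ) := Fin n → ℝ
abbrev Ten2 (n : ℕ) := Fin n → Fin n → ℝ
abbrev Ten3 (n : ℕ) := Fin n → Fin n → Fin n → ℝ
abbrev Ten4 (n : ℕ) := Fin n → Fin n → Fin n → Fin n → ℝ

variable {n : ℕ}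

/-- A (0,4)-tensor with the algebraic symmetries of a Riemann tensor. -/
def IsRiemannType (T : Ten4 n) : Prop :=
  (∀ α β μ ν, T α β μ ν = - T α β ν μ) ∧
  (∀ α β μ ν, T α β μ ν = - T β α μ ν) ∧
  (∀ α β μ ν, T α β μ ν = T μ ν α β) ∧
  (∀ α β μ ν, T α β μ ν + T α μ ν β + T α ν β μ = 0)

/-- A (0,3)-tensor antisymmetric in the last two indices with vanishing cyclic sum. -/
def IsLambda12 (F : Ten3 n) : Prop :=
  (∀ α μ ν, F α μ ν = - F α ν μ) ∧
  (∀ α μ ν, F α μ ν + F μ ν α + F ν α μ = 0)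

def IsSym2 (S : Ten2 n) : Prop := ∀ α β, S α β = S β α

/-- Ricci-type trace of a (0,4)-tensor (first and third indices, using the inverse metric). -/
def RicT (ginv : Ten2 n) (T : Ten4 n) : Ten2 n :=
  fun β ν => ∑ α, ∑ μ, ginv α μ * T α β μ ν

/-- Scalar-type trace. -/
def ScalT (ginv : Ten2 n) (T : Ten4 n) : ℝ :=
  ∑ β, ∑ ν, ginv β ν * RicT ginv T β ν

/-- Weyl-type: Riemann-type and trace-free in the first and third indices. -/
def IsWeylType (ginv : Ten2 n) (T : Ten4 n) : Prop :=
  IsRiemannType T ∧ ∀ β ν, RicT ginv T β ν = 0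

/-- Kulkarni–Nomizu product. -/
def KN (A B : Ten2 n) : Ten4 n := fun α β μ ν =>
  A α μ * B β ν - A α ν * B β μ - A β μ * B α ν + A β ν * B α μ

/-- (u ⊛ F) for a one-form w and F ∈ Λ^{(1,2)}. -/
def circ (w : Vec n) (F : Ten3 n) : Ten4 n := fun α β μ ν =>
  w α * F β μ ν - w β * F α μ ν + w μ * F ν α β - w ν * F μ α β

/-- Lower an index with the metric. -/
def lower (g : Ten2 n) (u : Vec n) : Vec n := fun α => ∑ β, g α β * u β

/-- Projector orthogonal to `u`, both indices covariant: γ_{αβ} = g_{αβ} − ε u_α u_β. -/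
def gam (g : Ten2 n) (ε : ℝ) (u : Vec n) : Ten2 n := fun α β =>
  g α β - ε * lower g u α * lower g u β

/-- Mixed projector γ^κ_μ = δ^κ_μ − ε u^κ u_μ. -/
def gamMix (g : Ten2 n) (ε : ℝ) (u : Vec n) : Ten2 n := fun κ μ =>
  (if κ = μ then (1 : ℝ) else 0) - ε * u κ * lower g u μ

/-- Contravariant projector γ^{αβ} = g^{αβ} − ε u^α u^β. -/
def gamUp (ginv : Ten2 n) (ε : ℝ) (u : Vec n) : Ten2 n := fun α β =>
  ginv α β - ε * u α * u β

/-- η := u⊗u − (ε/(n−3)) γ. -/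
def eta (g : Ten2 n) (ε : ℝ) (u : Vec n) : Ten2 n := fun α β =>
  lower g u α * lower g u β - (ε / ((n : ℝ) - 3)) * gam g ε u α β

/-- T^⊥_{βν} := u^α u^μ T_{αβμν}. -/
def perp (u : Vec n) (T : Ten4 n) : Ten2 n := fun β ν =>
  ∑ α, ∑ μ, u α * u μ * T α β μ ν

/-- T^{⊥∥}_{βμν} := u^α γ^κ_μ γ^σ_ν T_{αβκσ}. -/
def perppar (g : Ten2 n) (ε : ℝ) (u : Vec n) (T : Ten4 n) : Ten3 n := fun β μ ν =>
  ∑ α, ∑ κ, ∑ σ, u α * gamMix g ε u κ μ * gamMix g ε u σ ν * T α β κ σ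

/-- T^∥ : projection of T with γ in all four indices. -/
def par4 (g : Ten2 n) (ε : ℝ) (u : Vec n) (T : Ten4 n) : Ten4 n := fun α β μ ν =>
  ∑ ρ, ∑ σ, ∑ κ, ∑ δ,
    gamMix g ε u ρ α * gamMix g ε u σ β * gamMix g ε u κ μ * gamMix g ε u δ ν * T ρ σ κ δ

/-- T^{∥u} := T^∥ + (ε/(n−3)) T^⊥ ∧ γ. -/
def parU (g : Ten2 n) (ε : ℝ) (u : Vec n) (T : Ten4 n) : Ten4 n := fun α β μ ν =>
  par4 g ε u T α β μ ν + (ε / ((n : ℝ) - 3)) * KN (perp u T) (gam g ε u) α β μ ν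

/-- Complete orthogonality to `u` for (0,2)-tensors. -/
def Orth2 (u : Vec n) (S : Ten2 n) : Prop :=
  (∀ β, (∑ α, u α * S α β) = 0) ∧ (∀ β, (∑ α, u α * S β α) = 0)

/-- Complete orthogonality to `u` for (0,3)-tensors. -/
def Orth3 (u : Vec n) (F : Ten3 n) : Prop :=
  (∀ μ ν, (∑ α, u α * F α μ ν) = 0) ∧ (∀ μ ν, (∑ α, u α * F μ α ν) = 0) ∧
    (∀ μ ν, (∑ α, u α * F μ ν α) = 0)

/-- Complete orthogonality to `u` for (0,4)-tensors. -/
def Orth4 (u : Vec n) (T : Ten4 n) : Prop :=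
  (∀ β μ ν, (∑ α, u α * T α β μ ν) = 0) ∧ (∀ β μ ν, (∑ α, u α * T β α μ ν) = 0) ∧
    (∀ β μ ν, (∑ α, u α * T β μ α ν) = 0) ∧ (∀ β μ ν, (∑ α, u α * T β μ ν α) = 0)

/-- tr_γ of a (0,2)-tensor. -/
def trGam (ginv : Ten2 n) (ε : ℝ) (u : Vec n) (S : Ten2 n) : ℝ :=
  ∑ α, ∑ β, gamUp ginv ε u α β * S α β

/-- Schouten-type tensor of a (0,4)-tensor. -/
def SchT (g ginv : Ten2 n) (T : Ten4 n) : Ten2 n := fun β ν =>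
  (1 / ((n : ℝ) - 2)) * (RicT ginv T β ν - ScalT ginv T / (2 * ((n : ℝ) - 1)) * g β ν)

/-- Weyl-type part of a (0,4)-tensor: Weyl(T) := T − Sch(T) ∧ g. -/
def WeylT (g ginv : Ten2 n) (T : Ten4 n) : Ten4 n := fun α β μ ν =>
  T α β μ ν - KN (SchT g ginv T) g α β μ ν

/-- Sch_u for Riemann-type tensors completely orthogonal to u. -/
def SchU (g ginv : Ten2 n) (ε : ℝ) (u : Vec n) (P : Ten4 n) : Ten2 n := fun β ν =>
  (1 / ((n : ℝ) - 3)) * (RicT ginv P β ν - ScalT ginv P / (2 * ((n : ℝ) - 2)) * gam g ε u β ν)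

/-- Weyl_u for Riemann-type tensors completely orthogonal to u. -/
def WeylU (g ginv : Ten2 n) (ε : ℝ) (u : Vec n) (P : Ten4 n) : Ten4 n := fun α β μ ν =>
  P α β μ ν - KN (SchU g ginv ε u P) (gam g ε u) α β μ ν

/-- Z_tr := tr_γ T^⊥. -/
def Ztr (ginv : Ten2 n) (ε : ℝ) (u : Vec n) (T : Ten4 n) : ℝ :=
  trGam ginv ε u (perp u T)

/-- γ-trace-free part of an orthogonal symmetric (0,2)-tensor. -/
def hat2 (g ginv : Ten2 n) (ε : ℝ) (u : Vec n) (S : Ten2 n) : Ten2 n := fun β ν =>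
  S β ν - trGam ginv ε u S / ((n : ℝ) - 1) * gam g ε u β ν

/-- T̂^⊥ := T^⊥ − (Z_tr/(n−1)) γ. -/
def hatPerp (g ginv : Ten2 n) (ε : ℝ) (u : Vec n) (T : Ten4 n) : Ten2 n :=
  hat2 g ginv ε u (perp u T)

/-- (V_tr)_μ := γ^{αβ} T^{⊥∥}_{αβμ}. -/
def Vtr (g ginv : Ten2 n) (ε : ℝ) (u : Vec n) (T : Ten4 n) : Vec n := fun μ =>
  ∑ α, ∑ β, gamUp ginv ε u α β * perppar g ε u T α β μ

/-- T̂^{⊥∥}_{αβμ} := T^{⊥∥}_{αβμ} + (1/(n−2))(−γ_{αβ}(V_tr)_μ + γ_{αμ}(V_tr)_β). -/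
def hatPerppar (g ginv : Ten2 n) (ε : ℝ) (u : Vec n) (T : Ten4 n) : Ten3 n := fun α β μ =>
  perppar g ε u T α β μ + (1 / ((n : ℝ) - 2)) *
    (- gam g ε u α β * Vtr g ginv ε u T μ + gam g ε u α μ * Vtr g ginv ε u T β)

/-- S^∥_{βν} := γ^ρ_β γ^κ_ν S_{ρκ}. -/
def s2par (g : Ten2 n) (ε : ℝ) (u : Vec n) (S : Ten2 n) : Ten2 n := fun β ν =>
  ∑ ρ, ∑ κ, gamMix g ε u ρ β * gamMix g ε u κ ν * S ρ κ

/-- S^{⊥∥}_β := γ^ρ_β u^κ S_{ρκ}. -/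
def s2perppar (g : Ten2 n) (ε : ℝ) (u : Vec n) (S : Ten2 n) : Vec n := fun β =>
  ∑ ρ, ∑ κ, gamMix g ε u ρ β * u κ * S ρ κ

/-- S^⊥ := u^ρ u^κ S_{ρκ}. -/
def s2perp (u : Vec n) (S : Ten2 n) : ℝ := ∑ ρ, ∑ κ, u ρ * u κ * S ρ κ

/-- σ^{(2)}_{βν} := σ_{βρ} σ^ρ{}_ν. -/
def sq (ginv : Ten2 n) (σ : Ten2 n) : Ten2 n := fun β ν =>
  ∑ ρ, ∑ κ, σ β ρ * ginv ρ κ * σ κ ν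

/-- Mixed projector h^μ_{μ'} = γ^μ_{μ'} + ε y^μ y_{μ'} orthogonal to span{u,y}. -/
def hMix (g : Ten2 n) (ε : ℝ) (u y : Vec n) : Ten2 n := fun μ μ' =>
  gamMix g ε u μ μ' + ε * y μ * lower g y μ'

/-- Covariant projector h_{αβ} = γ_{αβ} + ε y_α y_β. -/
def hCov (g : Ten2 n) (ε : ℝ) (u y : Vec n) : Ten2 n := fun α β =>
  gam g ε u α β + ε * lower g y α * lower g y β

/-- g is a symmetric nondegenerate bilinear form with (symmetric) inverse ginv. -/
def GoodMetric (g ginv : Ten2 n) : Prop :=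
  (∀ α β, g α β = g β α) ∧ (∀ α β, ginv α β = ginv β α) ∧
    (∀ α β, (∑ μ, ginv α μ * g μ β) = if α = β then (1 : ℝ) else 0) ∧
    (∀ α β, (∑ μ, g α μ * ginv μ β) = if α = β then (1 : ℝ) else 0)

/-- u is a unit vector with g(u,u) = ε ∈ {−1,1}. -/
def UnitVec (g : Ten2 n) (ε : ℝ) (u : Vec n) : Prop :=
  (ε = 1 ∨ ε = -1) ∧ (∑ α, ∑ β, g α β * u α * u β) = ε


/-! ### Contractions with `u` -/

/-- Contraction of the first slot of a (0,4)-tensor with `u`. -/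
def contract (u : Vec n) (T : Ten4 n) : Ten3 n := fun β μ ν => ∑ α, u α * T α β μ ν

section Riemann

variable {T : Ten4 n} (u : Vec n)

lemma contract_snd (hT : IsRiemannType T) (α μ ν : Fin n) :
    ∑ β, u β * T α β μ ν = - contract u T α μ ν := by
  rw [contract, ← Finset.sum_neg_distrib]
  exact Finset.sum_congr rfl fun β _ => by rw [hT.2.1 α β]; ring

lemma contract_trd (hT : IsRiemannType T) (α β ν : Fin n) :
    ∑ μ, u μ * T α β μ ν = contract u T ν α β :=
  Finset.sum_congr rfl fun μ _ => by rw [hT.2.2.1 α β]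

lemma contract_fth (hT : IsRiemannType T) (α β μ : Fin n) :
    ∑ ν, u ν * T α β μ ν = - contract u T μ α β := by
  rw [contract, ← Finset.sum_neg_distrib]
  exact Finset.sum_congr rfl fun ν _ => by rw [hT.1 α β, hT.2.2.1 α β]; ring

lemma contract_antisymm (hT : IsRiemannType T) (β μ ν : Fin n) :
    contract u T β μ ν = - contract u T β ν μ := by
  rw [contract, contract, ← Finset.sum_neg_distrib]
  exact Finset.sum_congr rfl fun α _ => by rw [hT.1 α β μ ν]; ring

lemma sum_mul_contract_snd (β ν : Fin n) :
    ∑ μ, u μ * contract u T β μ ν = perp u T β ν := by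
  simp only [contract, perp, Finset.mul_sum]
  rw [Finset.sum_comm]
  exact Finset.sum_congr rfl fun α _ => Finset.sum_congr rfl fun μ _ => by ring

lemma sum_mul_contract_trd (hT : IsRiemannType T) (β μ : Fin n) :
    ∑ ν, u ν * contract u T β μ ν = - perp u T β μ := by
  rw [← sum_mul_contract_snd, ← Finset.sum_neg_distrib]
  exact Finset.sum_congr rfl fun ν _ => by rw [contract_antisymm u hT]; ring

lemma sum_mul_contract_fst (hT : IsRiemannType T) (μ ν : Fin n) :
    ∑ β, u β * contract u T β μ ν = 0 := by
  have h : ∑ β, u β * contract u T β μ ν = - ∑ β, u β * contract u T β μ ν := by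
    conv_lhs => simp only [contract, Finset.mul_sum]
    rw [Finset.sum_comm, ← Finset.sum_neg_distrib]
    refine Finset.sum_congr rfl fun α _ => ?_
    rw [contract, Finset.mul_sum, ← Finset.sum_neg_distrib]
    exact Finset.sum_congr rfl fun β _ => by rw [hT.2.1 α β]; ring
  linarith

lemma perp_symm (hT : IsRiemannType T) (β ν : Fin n) : perp u T β ν = perp u T ν β := by
  rw [perp, perp, Finset.sum_comm]
  exact Finset.sum_congr rfl fun μ _ => Finset.sum_congr rfl fun α _ => by
    rw [hT.2.2.1 α β]; ring

lemma sum_mul_perp_fst (hT : IsRiemannType T) (ν : Fin n) : ∑ β, u β * perp u T β ν = 0 := by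
  simp only [← sum_mul_contract_snd u, Finset.mul_sum]
  rw [Finset.sum_comm]
  refine Finset.sum_eq_zero fun μ _ => ?_
  rw [← mul_zero (u μ), ← sum_mul_contract_fst u hT μ ν, Finset.mul_sum]
  exact Finset.sum_congr rfl fun β _ => by ring

lemma sum_mul_perp_snd (hT : IsRiemannType T) (β : Fin n) : ∑ ν, u ν * perp u T β ν = 0 := by
  simpa only [perp_symm u hT β] using sum_mul_perp_fst u hT β

end Riemann

/-! ### The metric and the unit vector -/

section Metric

variable {g ginv : Ten2 n} {ε : ℝ} {u : Vec n}

lemma UnitVec.mul_self (hu : UnitVec g ε u) : ε * ε = 1 := by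
  rcases hu.1 with h | h <;> simp [h]

lemma UnitVec.sum_mul_lower (hu : UnitVec g ε u) : ∑ α, u α * lower g u α = ε := by
  rw [← hu.2]
  simp only [lower, Finset.mul_sum]
  exact Finset.sum_congr rfl fun α _ => Finset.sum_congr rfl fun β _ => by ring

lemma GoodMetric.sum_ginv_mul_lower (hg : GoodMetric g ginv) (α : Fin n) :
    ∑ μ, ginv α μ * lower g u μ = u α := by
  simp only [lower, Finset.mul_sum]
  rw [Finset.sum_comm]
  simp only [← mul_assoc, ← Finset.sum_mul, hg.2.2.1, ite_mul, one_mul, zero_mul,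
    Finset.sum_ite_eq, Finset.mem_univ, if_true]

lemma GoodMetric.trace_mul_lower (hg : GoodMetric g ginv) (f : Vec n) :
    ∑ α, ∑ μ, ginv α μ * (f α * lower g u μ) = ∑ α, u α * f α := by
  refine Finset.sum_congr rfl fun α _ => ?_
  rw [← hg.sum_ginv_mul_lower (u := u) α, Finset.sum_mul]
  exact Finset.sum_congr rfl fun μ _ => by ring

lemma GoodMetric.trace_lower_mul (hg : GoodMetric g ginv) (f : Vec n) :
    ∑ α, ∑ μ, ginv α μ * (lower g u α * f μ) = ∑ μ, u μ * f μ := by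
  rw [← hg.trace_mul_lower, Finset.sum_comm]
  exact Finset.sum_congr rfl fun μ _ => Finset.sum_congr rfl fun α _ => by
    rw [hg.2.1 α μ]; ring

lemma sum_gamMix_mul (f : Vec n) (μ : Fin n) :
    ∑ κ, gamMix g ε u κ μ * f κ = f μ - ε * lower g u μ * ∑ κ, u κ * f κ := by
  simp only [gamMix, sub_mul, Finset.sum_sub_distrib, ite_mul, one_mul, zero_mul,
    Finset.sum_ite_eq', Finset.mem_univ, if_true, Finset.mul_sum]
  congr 1
  exact Finset.sum_congr rfl fun κ _ => by ring

lemma trGam_eq_of_orthogonal {S : Ten2 n} (hS : ∀ α, ∑ β, u β * S α β = 0) :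
    trGam ginv ε u S = ∑ α, ∑ β, ginv α β * S α β := by
  refine Finset.sum_congr rfl fun α _ => ?_
  have h : ∑ β, gamUp ginv ε u α β * S α β
      = ∑ β, ginv α β * S α β - ε * u α * ∑ β, u β * S α β := by
    rw [Finset.mul_sum, ← Finset.sum_sub_distrib]
    exact Finset.sum_congr rfl fun β _ => by rw [gamUp]; ring
  rw [h, hS, mul_zero, sub_zero]

/-! ### Decomposition of a Riemann-type tensor -/

variable {T : Ten4 n}

lemma perppar_eq (hT : IsRiemannType T) (β μ ν : Fin n) :
    perppar g ε u T β μ ν = contract u T β μ ν - ε * lower g u μ * perp u T β ν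
      + ε * lower g u ν * perp u T β μ := by
  have h : perppar g ε u T β μ ν
      = ∑ κ, gamMix g ε u κ μ * ∑ σ, gamMix g ε u σ ν * contract u T β κ σ := by
    simp only [perppar, contract, Finset.mul_sum]
    rw [Finset.sum_comm]
    refine Finset.sum_congr rfl fun κ _ => ?_
    rw [Finset.sum_comm]
    exact Finset.sum_congr rfl fun σ _ => Finset.sum_congr rfl fun α _ => by ring
  have h₂ : ∑ κ, u κ * (contract u T β κ ν + ε * lower g u ν * perp u T β κ)
      = ∑ κ, u κ * contract u T β κ ν + ε * lower g u ν * ∑ κ, u κ * perp u T β κ := by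
    rw [Finset.mul_sum, ← Finset.sum_add_distrib]
    exact Finset.sum_congr rfl fun κ _ => by ring
  simp only [h, sum_gamMix_mul, sum_mul_contract_trd u hT, mul_neg, sub_neg_eq_add]
  rw [h₂, sum_mul_contract_snd, sum_mul_perp_snd u hT]
  ring

lemma perppar_antisymm (hT : IsRiemannType T) (β μ ν : Fin n) :
    perppar g ε u T β μ ν = - perppar g ε u T β ν μ := by
  rw [perppar_eq hT, perppar_eq hT, contract_antisymm u hT]
  ring

lemma sum_mul_perppar_fst (hT : IsRiemannType T) (μ ν : Fin n) :
    ∑ β, u β * perppar g ε u T β μ ν = 0 := by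
  have h : ∑ β, u β * perppar g ε u T β μ ν
      = ∑ β, u β * contract u T β μ ν - ε * lower g u μ * ∑ β, u β * perp u T β ν
        + ε * lower g u ν * ∑ β, u β * perp u T β μ := by
    simp only [Finset.mul_sum, ← Finset.sum_sub_distrib, ← Finset.sum_add_distrib]
    exact Finset.sum_congr rfl fun β _ => by rw [perppar_eq hT]; ring
  rw [h, sum_mul_contract_fst u hT, sum_mul_perp_fst u hT, sum_mul_perp_fst u hT]
  ring

lemma sum_mul_perppar_snd (hu : UnitVec g ε u) (hT : IsRiemannType T) (β ν : Fin n) :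
    ∑ μ, u μ * perppar g ε u T β μ ν = 0 := by
  have h : ∑ μ, u μ * perppar g ε u T β μ ν
      = ∑ μ, u μ * contract u T β μ ν - ε * perp u T β ν * ∑ μ, u μ * lower g u μ
        + ε * lower g u ν * ∑ μ, u μ * perp u T β μ := by
    simp only [Finset.mul_sum, ← Finset.sum_sub_distrib, ← Finset.sum_add_distrib]
    exact Finset.sum_congr rfl fun μ _ => by rw [perppar_eq hT]; ring
  rw [h, sum_mul_contract_snd, hu.sum_mul_lower, sum_mul_perp_snd u hT]
  linear_combination (- perp u T β ν) * hu.mul_self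

lemma sum_mul_perppar_trd (hu : UnitVec g ε u) (hT : IsRiemannType T) (β μ : Fin n) :
    ∑ ν, u ν * perppar g ε u T β μ ν = 0 := by
  simpa only [perppar_antisymm hT β μ, mul_neg, Finset.sum_neg_distrib, neg_eq_zero]
    using sum_mul_perppar_snd hu hT β μ

lemma par4_eq_iterated (α β μ ν : Fin n) :
    par4 g ε u T α β μ ν = ∑ ρ, gamMix g ε u ρ α * ∑ σ, gamMix g ε u σ β *
      ∑ κ, gamMix g ε u κ μ * ∑ δ, gamMix g ε u δ ν * T ρ σ κ δ := by
  simp only [par4, Finset.mul_sum, mul_assoc]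

lemma eq_par4_add (hu : UnitVec g ε u) (hT : IsRiemannType T) (α β μ ν : Fin n) :
    T α β μ ν = par4 g ε u T α β μ ν
      + ε * circ (lower g u) (perppar g ε u T) α β μ ν
      + KN (perp u T) (fun a b => lower g u a * lower g u b) α β μ ν := by
  have h₂ : ∀ ρ σ : Fin n,
      ∑ κ, u κ * (T ρ σ κ ν + ε * lower g u ν * contract u T κ ρ σ)
        = contract u T ν ρ σ := fun ρ σ => by
    rw [← contract_trd u hT, ← add_zero (∑ κ, u κ * T ρ σ κ ν),
      ← mul_zero (ε * lower g u ν), ← sum_mul_contract_fst u hT ρ σ, Finset.mul_sum,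
      ← Finset.sum_add_distrib]
    exact Finset.sum_congr rfl fun κ _ => by ring
  have h₃ : ∀ ρ : Fin n,
      ∑ σ, u σ * (T ρ σ μ ν + ε * lower g u ν * contract u T μ ρ σ
          - ε * lower g u μ * contract u T ν ρ σ)
        = - contract u T ρ μ ν - ε * lower g u ν * perp u T ρ μ
          + ε * lower g u μ * perp u T ρ ν := fun ρ => by
    have e : ∑ σ, u σ * (T ρ σ μ ν + ε * lower g u ν * contract u T μ ρ σ
          - ε * lower g u μ * contract u T ν ρ σ)
        = ∑ σ, u σ * T ρ σ μ ν + ε * lower g u ν * ∑ σ, u σ * contract u T μ ρ σ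
          - ε * lower g u μ * ∑ σ, u σ * contract u T ν ρ σ := by
      simp only [Finset.mul_sum, ← Finset.sum_sub_distrib, ← Finset.sum_add_distrib]
      exact Finset.sum_congr rfl fun σ _ => by ring
    rw [e, contract_snd u hT, sum_mul_contract_trd u hT, sum_mul_contract_trd u hT,
      perp_symm u hT μ, perp_symm u hT ν]
    ring
  have h₄ : ∑ ρ, u ρ * (T ρ β μ ν + ε * lower g u ν * contract u T μ ρ β
          - ε * lower g u μ * contract u T ν ρ β
          - ε * lower g u β * (- contract u T ρ μ ν - ε * lower g u ν * perp u T ρ μ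
            + ε * lower g u μ * perp u T ρ ν))
      = contract u T β μ ν + ε * lower g u ν * perp u T μ β
          - ε * lower g u μ * perp u T ν β := by
    have e : ∑ ρ, u ρ * (T ρ β μ ν + ε * lower g u ν * contract u T μ ρ β
          - ε * lower g u μ * contract u T ν ρ β
          - ε * lower g u β * (- contract u T ρ μ ν - ε * lower g u ν * perp u T ρ μ
            + ε * lower g u μ * perp u T ρ ν))
        = ∑ ρ, u ρ * T ρ β μ ν + ε * lower g u ν * ∑ ρ, u ρ * contract u T μ ρ β
          - ε * lower g u μ * ∑ ρ, u ρ * contract u T ν ρ β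
          + ε * lower g u β * ∑ ρ, u ρ * contract u T ρ μ ν
          + ε * lower g u β * (ε * lower g u ν) * ∑ ρ, u ρ * perp u T ρ μ
          - ε * lower g u β * (ε * lower g u μ) * ∑ ρ, u ρ * perp u T ρ ν := by
      simp only [Finset.mul_sum, ← Finset.sum_sub_distrib, ← Finset.sum_add_distrib]
      exact Finset.sum_congr rfl fun ρ _ => by ring
    rw [e, sum_mul_contract_snd, sum_mul_contract_snd, sum_mul_contract_fst u hT,
      sum_mul_perp_fst u hT, sum_mul_perp_fst u hT, contract]
    ring
  rw [par4_eq_iterated]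
  simp only [sum_gamMix_mul, contract_fth u hT, mul_neg, sub_neg_eq_add, h₂, h₃]
  rw [h₄]
  simp only [circ, KN, perppar_eq hT]
  rw [perp_symm u hT μ β, perp_symm u hT ν β, perp_symm u hT μ α, perp_symm u hT ν α]
  rcases hu.1 with rfl | rfl <;> ring

lemma sum_mul_par4_fth (hu : UnitVec g ε u) (hT : IsRiemannType T) (α β μ : Fin n) :
    ∑ ν, u ν * par4 g ε u T α β μ ν = 0 := by
  have h : ∑ ν, u ν * par4 g ε u T α β μ ν
      = ∑ ν, u ν * T α β μ ν
        - ε * (lower g u α * ∑ ν, u ν * perppar g ε u T β μ ν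
          - lower g u β * ∑ ν, u ν * perppar g ε u T α μ ν
          + lower g u μ * ∑ ν, u ν * perppar g ε u T ν α β
          - perppar g ε u T μ α β * ∑ ν, u ν * lower g u ν)
        - (perp u T α μ * lower g u β * ∑ ν, u ν * lower g u ν
          - lower g u β * lower g u μ * ∑ ν, u ν * perp u T α ν
          - perp u T β μ * lower g u α * ∑ ν, u ν * lower g u ν
          + lower g u α * lower g u μ * ∑ ν, u ν * perp u T β ν) := by
    simp only [Finset.mul_sum, ← Finset.sum_sub_distrib, ← Finset.sum_add_distrib]
    refine Finset.sum_congr rfl fun ν _ => ?_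
    rw [eq_par4_add hu hT α β μ ν, circ, KN]
    ring
  rw [h, contract_fth u hT, hu.sum_mul_lower, sum_mul_perppar_trd hu hT,
    sum_mul_perppar_trd hu hT, sum_mul_perppar_fst hT, sum_mul_perp_snd u hT,
    sum_mul_perp_snd u hT, perppar_eq hT, perp_symm u hT μ α, perp_symm u hT μ β]
  rcases hu.1 with rfl | rfl <;> ring

/-! ### Traces -/

lemma sum_mul_RicT_par4 (hu : UnitVec g ε u) (hT : IsRiemannType T) (β : Fin n) :
    ∑ ν, u ν * RicT ginv (par4 g ε u T) β ν = 0 := by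
  simp only [RicT, Finset.mul_sum]
  rw [Finset.sum_comm]
  refine Finset.sum_eq_zero fun α _ => ?_
  rw [Finset.sum_comm]
  refine Finset.sum_eq_zero fun μ _ => ?_
  rw [← mul_zero (ginv α μ), ← sum_mul_par4_fth hu hT α β μ, Finset.mul_sum]
  exact Finset.sum_congr rfl fun ν _ => by ring

lemma trGam_RicT_par4 (hu : UnitVec g ε u) (hT : IsRiemannType T) :
    trGam ginv ε u (RicT ginv (par4 g ε u T)) = ScalT ginv (par4 g ε u T) :=
  trGam_eq_of_orthogonal (sum_mul_RicT_par4 hu hT)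

lemma Vtr_eq (hu : UnitVec g ε u) (hT : IsRiemannType T) (μ : Fin n) :
    Vtr g ginv ε u T μ = ∑ α, ∑ β, ginv α β * perppar g ε u T α β μ :=
  trGam_eq_of_orthogonal (S := fun α β => perppar g ε u T α β μ)
    fun α => sum_mul_perppar_snd hu hT α μ

lemma sum_mul_Vtr (hu : UnitVec g ε u) (hT : IsRiemannType T) :
    ∑ μ, u μ * Vtr g ginv ε u T μ = 0 := by
  simp only [Vtr, Finset.mul_sum]
  rw [Finset.sum_comm]
  refine Finset.sum_eq_zero fun α _ => ?_
  rw [Finset.sum_comm]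
  refine Finset.sum_eq_zero fun β _ => ?_
  rw [← mul_zero (gamUp ginv ε u α β), ← sum_mul_perppar_trd hu hT α β, Finset.mul_sum]
  exact Finset.sum_congr rfl fun μ _ => by ring

lemma Ztr_eq (hT : IsRiemannType T) :
    Ztr ginv ε u T = ∑ α, ∑ β, ginv α β * perp u T α β :=
  trGam_eq_of_orthogonal (sum_mul_perp_snd u hT)

lemma RicT_eq (hg : GoodMetric g ginv) (hu : UnitVec g ε u) (hT : IsRiemannType T)
    (β ν : Fin n) :
    RicT ginv T β ν = RicT ginv (par4 g ε u T) β ν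
      - ε * (lower g u β * Vtr g ginv ε u T ν + lower g u ν * Vtr g ginv ε u T β)
      + ε * perp u T β ν + Ztr ginv ε u T * (lower g u β * lower g u ν) := by
  have h : RicT ginv T β ν = RicT ginv (par4 g ε u T) β ν
      + ε * ((∑ α, ∑ μ, ginv α μ * (lower g u α * perppar g ε u T β μ ν))
        - lower g u β * (∑ α, ∑ μ, ginv α μ * perppar g ε u T α μ ν)
        + (∑ α, ∑ μ, ginv α μ * (perppar g ε u T ν α β * lower g u μ))
        - lower g u ν * (∑ α, ∑ μ, ginv α μ * perppar g ε u T μ α β))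
      + lower g u β * lower g u ν * (∑ α, ∑ μ, ginv α μ * perp u T α μ)
      - lower g u β * (∑ α, ∑ μ, ginv α μ * (perp u T α ν * lower g u μ))
      - lower g u ν * (∑ α, ∑ μ, ginv α μ * (lower g u α * perp u T β μ))
      + perp u T β ν * (∑ α, ∑ μ, ginv α μ * (lower g u α * lower g u μ)) := by
    simp only [RicT, Finset.mul_sum, ← Finset.sum_sub_distrib, ← Finset.sum_add_distrib]
    refine Finset.sum_congr rfl fun α _ => Finset.sum_congr rfl fun μ _ => ?_
    rw [eq_par4_add hu hT α β μ ν, circ, KN]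
    ring
  have hV : ∑ α, ∑ μ, ginv α μ * perppar g ε u T μ α β = Vtr g ginv ε u T β := by
    rw [Vtr_eq hu hT, Finset.sum_comm]
    exact Finset.sum_congr rfl fun μ _ => Finset.sum_congr rfl fun α _ => by
      rw [hg.2.1 α μ]
  rw [h, hV, ← Vtr_eq hu hT, ← Ztr_eq hT, hg.trace_lower_mul, hg.trace_mul_lower,
    hg.trace_mul_lower, hg.trace_lower_mul, hg.trace_lower_mul, sum_mul_perppar_snd hu hT,
    sum_mul_perppar_snd hu hT, sum_mul_perp_fst u hT, sum_mul_perp_snd u hT,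
    hu.sum_mul_lower]
  ring

lemma ScalT_eq (hg : GoodMetric g ginv) (hu : UnitVec g ε u) (hT : IsRiemannType T) :
    ScalT ginv T = ScalT ginv (par4 g ε u T) + 2 * ε * Ztr ginv ε u T := by
  have h : ScalT ginv T = ScalT ginv (par4 g ε u T)
      - ε * ((∑ β, ∑ ν, ginv β ν * (lower g u β * Vtr g ginv ε u T ν))
        + ∑ β, ∑ ν, ginv β ν * (Vtr g ginv ε u T β * lower g u ν))
      + ε * (∑ β, ∑ ν, ginv β ν * perp u T β ν)
      + Ztr ginv ε u T * ∑ β, ∑ ν, ginv β ν * (lower g u β * lower g u ν) := by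
    simp only [ScalT, Finset.mul_sum, ← Finset.sum_sub_distrib, ← Finset.sum_add_distrib]
    refine Finset.sum_congr rfl fun β _ => Finset.sum_congr rfl fun ν _ => ?_
    rw [RicT_eq hg hu hT]
    ring
  rw [h, hg.trace_lower_mul, hg.trace_mul_lower, hg.trace_lower_mul, sum_mul_Vtr hu hT,
    ← Ztr_eq hT, hu.sum_mul_lower]
  ring

end Metric

/-- Proposition `DecomSchWeyl-type`, Weyl part: decomposition of
`Weyl(T)` with respect to `u`. -/
theorem stmt6 {n : ℕ} (hn : 4 ≤ n) (g ginv : Ten2 n) (hg : GoodMetric g ginv)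
    (ε : ℝ) (u : Vec n) (hu : UnitVec g ε u)
    (T : Ten4 n) (hT : IsRiemannType T) :
    ∀ α β μ ν, WeylT g ginv T α β μ ν =
      WeylU g ginv ε u (par4 g ε u T) α β μ ν
      + ε * circ (lower g u) (hatPerppar g ginv ε u T) α β μ ν
      + KN (fun β' ν' => (1 / ((n : ℝ) - 2)) *
            (((n : ℝ) - 3) * hatPerp g ginv ε u T β' ν'
              - ε * hat2 g ginv ε u (RicT ginv (par4 g ε u T)) β' ν'))
          (eta g ε u) α β μ ν := by
  intro α β μ ν
  have hn' : (4 : ℝ) ≤ n := by exact_mod_cast hn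
  have h₁ : (n : ℝ) - 1 ≠ 0 := by linarith
  have h₂ : (n : ℝ) - 2 ≠ 0 := by linarith
  have h₃ : (n : ℝ) - 3 ≠ 0 := by linarith
  rw [WeylT, eq_par4_add hu hT α β μ ν]
  simp only [WeylU, SchT, SchU, hatPerp, hat2, trGam_RicT_par4 hu hT, Ztr,
    ScalT_eq hg hu hT, RicT_eq hg hu hT, hatPerppar, circ, KN, eta, gam]
  rw [hg.1 ν α, hg.1 ν β, hg.1 μ α, hg.1 μ β]
  rcases hu.1 with rfl | rfl <;> field_simp <;> ring

end Decomp
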